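/- arXiv:math/0508627 — 3 statements merged into one kernel-verified Lean document; each statement's English description precedes it below -/
import Mathlib

section
/- Let H : ℝ^N → ℝ^N be Lipschitz, Λ : ℝ^N → ℝ^m, τ > 0, Ω ⊆ ℝ^m open, and let G_f, G : Ω → ℝ^N be differentiable maps satisfying the invariance PDE: for every c ∈ Ω, (DG_f)(c)[v(c)] = H(G_f(c)) and (DG)(c)[v(c)] = H(G(c)), where v(c) := (1/τ)(Λ(G_f(c)) − Λ(G(c))). Let f : ℝ → ℝ^N solve f' = H(f) with f(0) = f_*, let I be an interval containing 0, and let c : I → Ω be differentiable with c'(t) = v(c(t)) on I and c(0) = c_* ∈ Ω. If the matching conditions G(c_*) = f_* and G_f(c_*) = f(τ) hold, then G(c(t)) = f(t) and G_f(c(t)) = f(t + τ) for all t ∈ I. -/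
/-- Two solutions of an autonomous ODE with Lipschitz right-hand side on an order-connected set
agree there as soon as they agree at one point. -/
theorem LipschitzWith.eqOn_of_hasDerivAt {E : Type*} [NormedAddCommGroup E] [NormedSpace ℝ E]
    {H : E → E} {K : NNReal} (hH : LipschitzWith K H) {I : Set ℝ} (hI : I.OrdConnected)
    {t₀ : ℝ} (ht₀ : t₀ ∈ I) {x y : ℝ → E} (hx : ∀ t ∈ I, HasDerivAt x (H (x t)) t)
    (hy : ∀ t ∈ I, HasDerivAt y (H (y t)) t) (h : x t₀ = y t₀) : Set.EqOn x y I := by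
  intro t ht
  rcases le_total t₀ t with hle | hle
  · have hsub : Set.Icc t₀ t ⊆ I := hI.out ht₀ ht
    exact ODE_solution_unique_of_mem_Icc_right (v := fun _ => H) (s := fun _ => Set.univ)
      (fun _ _ => hH.lipschitzOnWith)
      (HasDerivAt.continuousOn fun s hs => hx s (hsub hs))
      (fun s hs => (hx s (hsub (Set.Ico_subset_Icc_self hs))).hasDerivWithinAt)
      (fun _ _ => trivial)
      (HasDerivAt.continuousOn fun s hs => hy s (hsub hs))
      (fun s hs => (hy s (hsub (Set.Ico_subset_Icc_self hs))).hasDerivWithinAt)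
      (fun _ _ => trivial) h ⟨hle, le_rfl⟩
  · have hsub : Set.Icc t t₀ ⊆ I := hI.out ht ht₀
    exact ODE_solution_unique_of_mem_Icc_left (v := fun _ => H) (s := fun _ => Set.univ)
      (fun _ _ => hH.lipschitzOnWith)
      (HasDerivAt.continuousOn fun s hs => hx s (hsub hs))
      (fun s hs => (hx s (hsub (Set.Ioc_subset_Icc_self hs))).hasDerivWithinAt)
      (fun _ _ => trivial)
      (HasDerivAt.continuousOn fun s hs => hy s (hsub hs))
      (fun s hs => (hy s (hsub (Set.Ioc_subset_Icc_self hs))).hasDerivWithinAt)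
      (fun _ _ => trivial) h ⟨le_rfl, hle⟩

/-- With `H` Lipschitz, suppose `(G_f, G)` satisfies the invariance PDE on an
open set `Ω`, `f` solves the fine ODE `f' = H(f)` with `f(0) = f_*`, and `c` solves the
coarse ODE `c' = v(c)` on an interval `I` containing `0` with `c(0) = c_* ∈ Ω`. If the
matching conditions `G(c_*) = f_*` and `G_f(c_*) = f(τ)` hold, then `G(c(t)) = f(t)` and
`G_f(c(t)) = f(t + τ)` for all `t ∈ I`. -/
theorem matched_manifold_reproduces_fine {N m : ℕ}
    (H : (Fin N → ℝ) → (Fin N → ℝ)) (K : NNReal) (hH : LipschitzWith K H)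
    (Λ : (Fin N → ℝ) → (Fin m → ℝ)) (τ : ℝ) (hτ : 0 < τ)
    (Ω : Set (Fin m → ℝ)) (hΩ : IsOpen Ω)
    (Gf G : (Fin m → ℝ) → (Fin N → ℝ))
    (hGfdiff : ∀ c ∈ Ω, DifferentiableAt ℝ Gf c)
    (hGdiff : ∀ c ∈ Ω, DifferentiableAt ℝ G c)
    (hPDEf : ∀ c ∈ Ω, fderiv ℝ Gf c (τ⁻¹ • (Λ (Gf c) - Λ (G c))) = H (Gf c))
    (hPDE : ∀ c ∈ Ω, fderiv ℝ G c (τ⁻¹ • (Λ (Gf c) - Λ (G c))) = H (G c))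
    (f : ℝ → (Fin N → ℝ)) (fstar : Fin N → ℝ)
    (hf : ∀ t : ℝ, HasDerivAt f (H (f t)) t) (hf0 : f 0 = fstar)
    (I : Set ℝ) (hI : I.OrdConnected) (h0I : (0 : ℝ) ∈ I)
    (c : ℝ → (Fin m → ℝ)) (cstar : Fin m → ℝ) (hcstarΩ : cstar ∈ Ω)
    (hcΩ : ∀ t ∈ I, c t ∈ Ω)
    (hc : ∀ t ∈ I, HasDerivAt c (τ⁻¹ • (Λ (Gf (c t)) - Λ (G (c t)))) t)
    (hc0 : c 0 = cstar)
    (hmatch : G cstar = fstar) (hmatchf : Gf cstar = f τ) :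
    ∀ t ∈ I, G (c t) = f t ∧ Gf (c t) = f (t + τ) := by
  have chain : ∀ F : (Fin m → ℝ) → (Fin N → ℝ), (∀ x ∈ Ω, DifferentiableAt ℝ F x) →
      (∀ x ∈ Ω, fderiv ℝ F x (τ⁻¹ • (Λ (Gf x) - Λ (G x))) = H (F x)) →
      ∀ t ∈ I, HasDerivAt (fun s => F (c s)) (H (F (c t))) t := by
    intro F hF hFPDE t ht
    rw [← hFPDE (c t) (hcΩ t ht)]
    exact (hF (c t) (hcΩ t ht)).hasFDerivAt.comp_hasDerivAt t (hc t ht)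
  have hG0 : G (c 0) = f 0 := by rw [hc0, hmatch, hf0]
  have hGf0 : Gf (c 0) = f (0 + τ) := by rw [hc0, hmatchf, zero_add]
  have hshift : ∀ t ∈ I, HasDerivAt (fun s => f (s + τ)) (H (f (t + τ))) t :=
    fun t _ => (hf (t + τ)).comp_add_const t τ
  intro t ht
  exact ⟨hH.eqOn_of_hasDerivAt hI h0I (chain G hGdiff hPDE) (fun s _ => hf s) hG0 ht,
    hH.eqOn_of_hasDerivAt hI h0I (chain Gf hGfdiff hPDEf) hshift hGf0 ht⟩
end

section
/- Let H : ℝ^N → ℝ^N be Lipschitz, Λ : ℝ^N → ℝ^m continuous, τ > 0, Ω ⊆ ℝ^m open, and let G_f, G : Ω → ℝ^N be differentiable maps satisfying the invariance PDE: for every c ∈ Ω, (DG_f)(c)[v(c)] = H(G_f(c)) and (DG)(c)[v(c)] = H(G(c)), where v(c) := (1/τ)(Λ(G_f(c)) − Λ(G(c))). Let f : ℝ → ℝ^N solve f' = H(f) with f(0) = f_*, let I be an interval containing 0, and let c : I → Ω be differentiable with c'(t) = v(c(t)) on I and c(0) = c_* = (1/τ) ∫_0^τ Λ(f(s)) ds.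 If G(c_*) = f_* and G_f(c_*) = f(τ), then the coarse theory reproduces the exact running time average: c(t) = (1/τ) ∫_t^{t+τ} Λ(f(s)) ds for all t ∈ I. -/
/-- Two solutions of an autonomous ODE with globally Lipschitz right-hand side on an interval
which agree at one point of the interval agree on the whole interval. -/
theorem eqOn_of_hasDerivAt_of_lipschitzWith {E : Type*} [NormedAddCommGroup E] [NormedSpace ℝ E]
    {H : E → E} {K : NNReal} (hH : LipschitzWith K H) {I : Set ℝ} (hI : I.OrdConnected)
    {u w : ℝ → E} (hu : ∀ t ∈ I, HasDerivAt u (H (u t)) t)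
    (hw : ∀ t ∈ I, HasDerivAt w (H (w t)) t) {a : ℝ} (ha : a ∈ I) (h : u a = w a) :
    Set.EqOn u w I := by
  intro t ht
  rcases le_total a t with hat | hta
  · have hsub : Set.Icc a t ⊆ I := hI.out ha ht
    exact ODE_solution_unique (v := fun _ => H) (K := K) (fun _ => hH)
      (fun s hs => (hu s (hsub hs)).continuousAt.continuousWithinAt)
      (fun s hs => (hu s (hsub (Set.Ico_subset_Icc_self hs))).hasDerivWithinAt)
      (fun s hs => (hw s (hsub hs)).continuousAt.continuousWithinAt)
      (fun s hs => (hw s (hsub (Set.Ico_subset_Icc_self hs))).hasDerivWithinAt)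
      h (Set.right_mem_Icc.2 hat)
  · have hsub : Set.Icc t a ⊆ I := hI.out ht ha
    exact ODE_solution_unique_of_mem_Icc_left (v := fun _ => H) (s := fun _ => Set.univ) (K := K)
      (fun _ _ => hH.lipschitzOnWith)
      (fun s hs => (hu s (hsub hs)).continuousAt.continuousWithinAt)
      (fun s hs => (hu s (hsub (Set.Ioc_subset_Icc_self hs))).hasDerivWithinAt)
      (fun _ _ => Set.mem_univ _)
      (fun s hs => (hw s (hsub hs)).continuousAt.continuousWithinAt)
      (fun s hs => (hw s (hsub (Set.Ioc_subset_Icc_self hs))).hasDerivWithinAt)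
      (fun _ _ => Set.mem_univ _)
      h (Set.left_mem_Icc.2 hta)

/-- The integral of a continuous function over a sliding window has as derivative the difference
of the values at the end points of the window. -/
theorem hasDerivAt_integral_window {E : Type*} [NormedAddCommGroup E] [NormedSpace ℝ E]
    [CompleteSpace E] {g : ℝ → E} (hg : Continuous g) (τ t : ℝ) :
    HasDerivAt (fun t => ∫ s in t..(t + τ), g s) (g (t + τ) - g t) t := by
  have key : ∀ x : ℝ, HasDerivAt (fun y => ∫ s in (0 : ℝ)..y, g s) (g x) x := fun x =>
    hg.integral_hasStrictDerivAt 0 x |>.hasDerivAt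
  have h := ((key (t + τ)).comp_add_const t τ).sub (key t)
  refine h.congr_of_eventuallyEq (Filter.Eventually.of_forall fun y => ?_)
  exact (intervalIntegral.integral_interval_sub_left
    (hg.intervalIntegrable _ _) (hg.intervalIntegrable _ _)).symm


/-- Under the hypotheses of the matching theorem (Lipschitz `H`, continuous
`Λ`, invariance PDE for `(G_f, G)` on open `Ω`, fine solution `f` with `f(0) = f_*`,
coarse solution `c` of the coarse ODE on an interval `I` containing `0` with
`c(0) = c_* = (1/τ)∫_0^τ Λ(f(s)) ds`, and matching conditions `G(c_*) = f_*`,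
`G_f(c_*) = f(τ)`), the coarse theory reproduces the exact running time average:
`c(t) = (1/τ) ∫_t^{t+τ} Λ(f(s)) ds` for all `t ∈ I`. -/
theorem coarse_theory_reproduces_time_average {N m : ℕ}
    (H : (Fin N → ℝ) → (Fin N → ℝ)) (K : NNReal) (hH : LipschitzWith K H)
    (Λ : (Fin N → ℝ) → (Fin m → ℝ)) (hΛ : Continuous Λ) (τ : ℝ) (hτ : 0 < τ)
    (Ω : Set (Fin m → ℝ)) (hΩ : IsOpen Ω)
    (Gf G : (Fin m → ℝ) → (Fin N → ℝ))
    (hGfdiff : ∀ c ∈ Ω, DifferentiableAt ℝ Gf c)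
    (hGdiff : ∀ c ∈ Ω, DifferentiableAt ℝ G c)
    (hPDEf : ∀ c ∈ Ω, fderiv ℝ Gf c (τ⁻¹ • (Λ (Gf c) - Λ (G c))) = H (Gf c))
    (hPDE : ∀ c ∈ Ω, fderiv ℝ G c (τ⁻¹ • (Λ (Gf c) - Λ (G c))) = H (G c))
    (f : ℝ → (Fin N → ℝ)) (fstar : Fin N → ℝ)
    (hf : ∀ t : ℝ, HasDerivAt f (H (f t)) t) (hf0 : f 0 = fstar)
    (I : Set ℝ) (hI : I.OrdConnected) (h0I : (0 : ℝ) ∈ I)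
    (c : ℝ → (Fin m → ℝ)) (cstar : Fin m → ℝ) (hcstarΩ : cstar ∈ Ω)
    (hcstar : cstar = τ⁻¹ • ∫ s in (0 : ℝ)..τ, Λ (f s))
    (hcΩ : ∀ t ∈ I, c t ∈ Ω)
    (hc : ∀ t ∈ I, HasDerivAt c (τ⁻¹ • (Λ (Gf (c t)) - Λ (G (c t)))) t)
    (hc0 : c 0 = cstar)
    (hmatch : G cstar = fstar) (hmatchf : Gf cstar = f τ) :
    ∀ t ∈ I, c t = τ⁻¹ • ∫ s in t..(t + τ), Λ (f s) := by
  have hfcont : Continuous f := continuous_iff_continuousAt.2 fun t => (hf t).continuousAt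
  have hlift : ∀ {F : (Fin m → ℝ) → (Fin N → ℝ)}, (∀ x ∈ Ω, DifferentiableAt ℝ F x) →
      (∀ x ∈ Ω, fderiv ℝ F x (τ⁻¹ • (Λ (Gf x) - Λ (G x))) = H (F x)) →
      ∀ t ∈ I, HasDerivAt (fun t => F (c t)) (H (F (c t))) t := by
    intro F hF hFPDE t ht
    have h := (hF _ (hcΩ t ht)).hasFDerivAt.comp_hasDerivAt t (hc t ht)
    rwa [hFPDE _ (hcΩ t ht)] at h
  have hG : Set.EqOn (fun t => G (c t)) f I :=
    eqOn_of_hasDerivAt_of_lipschitzWith hH hI (hlift hGdiff hPDE) (fun t _ => hf t) h0I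
      (by simp only [hc0, hmatch, hf0])
  have hGf : Set.EqOn (fun t => Gf (c t)) (fun t => f (t + τ)) I :=
    eqOn_of_hasDerivAt_of_lipschitzWith hH hI (hlift hGfdiff hPDEf)
      (fun t _ => (hf (t + τ)).comp_add_const t τ) h0I
      (by simp only [hc0, hmatchf, zero_add])
  have hdiff : ∀ t ∈ I, HasDerivWithinAt
      (fun t => c t - τ⁻¹ • ∫ s in t..(t + τ), Λ (f s)) 0 I t := by
    intro t ht
    have h := (hc t ht).sub
      ((hasDerivAt_integral_window (hΛ.comp hfcont) τ t).const_smul τ⁻¹)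
    have hGt : G (c t) = f t := hG ht
    have hGft : Gf (c t) = f (t + τ) := hGf ht
    rw [hGt, hGft] at h
    exact (h.congr_deriv (sub_self _)).hasDerivWithinAt
  intro t ht
  have hconst := hI.convex.norm_image_sub_le_of_norm_hasDerivWithin_le hdiff
    (fun _ _ => norm_zero.le) h0I ht
  rw [zero_mul, norm_le_zero_iff] at hconst
  simp only [zero_add, hc0, ← hcstar, sub_self, sub_zero] at hconst
  exact sub_eq_zero.1 hconst
end

section
/- Let H : ℝ^N → ℝ^N be Lipschitz, Λ : ℝ^N → ℝ^m Lipschitz, τ > 0, Ω ⊆ ℝ^m open, and let G_f, G : Ω → ℝ^N be continuously differentiable maps satisfying the invariance PDE: for every c ∈ Ω, (DG_f)(c)[v(c)] = H(G_f(c)) and (DG)(c)[v(c)] = H(G(c)), where v(c) := (1/τ)(Λ(G_f(c)) − Λ(G(c))). Then for every c_* ∈ Ω there exist δ > 0 and a differentiable curve c : (−δ, δ) → Ω with c(0) = c_* and c'(t) = v(c(t)), and the unique solution (f_f, f) of the augmented fine system f_f' = H(f_f), f' = H(f) with initial data (f_f(0), f(0)) = (G_f(c_*), G(c_*)) satisfies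 (f_f(t), f(t)) = (G_f(c(t)), G(c(t))) for all t ∈ (−δ, δ); i.e., trajectories of the augmented fine system starting on the graph of (G_f, G) remain on that graph locally in time. -/
open Set Metric Filter Topology in
/-- A vector field that is Lipschitz on a neighbourhood `s` of `x₀` has an integral curve through
`x₀`, defined on an open time interval and staying in `s`. -/
theorem LipschitzOnWith.exists_integralCurve_mem {E : Type*} [NormedAddCommGroup E]
    [NormedSpace ℝ E] [CompleteSpace E] {v : E → E} {s : Set E} {x₀ : E} {K : NNReal}
    (hv : LipschitzOnWith K v s) (hs : s ∈ 𝓝 x₀) :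
    ∃ δ > (0 : ℝ), ∃ c : ℝ → E, c 0 = x₀ ∧ (∀ t ∈ Ioo (-δ) δ, c t ∈ s) ∧
      ∀ t ∈ Ioo (-δ) δ, HasDerivAt c (v (c t)) t := by
  obtain ⟨a, ha, has⟩ := nhds_basis_closedBall.mem_iff.mp hs
  lift a to NNReal using ha.le
  set L : NNReal := K * a + ‖v x₀‖₊ + 1 with hL
  have hLpos : (0 : ℝ) < L := by rw [hL]; positivity
  have hbound : ∀ x ∈ closedBall x₀ a, ‖v x‖ ≤ L := fun x hx ↦ calc
    ‖v x‖ ≤ ‖v x - v x₀‖ + ‖v x₀‖ := norm_le_norm_sub_add _ _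
    _ ≤ K * ‖x - x₀‖ + ‖v x₀‖ := by
      gcongr
      exact hv.norm_sub_le (has hx) (mem_of_mem_nhds hs)
    _ ≤ K * a + ‖v x₀‖ := by
      gcongr
      exact mem_closedBall_iff_norm.mp hx
    _ ≤ L := by simp [hL]
  set ε : ℝ := a / L
  have hε : 0 < ε := div_pos ha hLpos
  have hpl : IsPicardLindelof (fun _ ↦ v) (tmin := -ε) (tmax := ε)
      ⟨0, by simp [hε.le]⟩ x₀ a 0 L K :=
    .of_time_independent hbound (hv.mono has) (by simp [ε, mul_div_cancel₀ _ hLpos.ne'])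
  obtain ⟨c, hc0, hc⟩ := hpl.exists_eq_forall_mem_Icc_hasDerivWithinAt₀
  have hderiv : ∀ t ∈ Ioo (-ε) ε, HasDerivAt c (v (c t)) t := fun t ht ↦
    (hc t (Ioo_subset_Icc_self ht)).hasDerivAt (Icc_mem_nhds ht.1 ht.2)
  have hcs : ∀ᶠ t in 𝓝 0, c t ∈ s :=
    (hderiv 0 (by simp [hε])).continuousAt.eventually_mem (by simpa [← hc0] using hs)
  obtain ⟨η, hη, hηs⟩ := Metric.eventually_nhds_iff_ball.mp hcs
  refine ⟨min ε η, lt_min hε hη, c, hc0, fun t ht ↦ hηs t ?_, fun t ht ↦ hderiv t ?_⟩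
  · rw [Real.ball_eq_Ioo, zero_sub, zero_add]
    exact Ioo_subset_Ioo (neg_le_neg (min_le_right _ _)) (min_le_right _ _) ht
  · exact Ioo_subset_Ioo (neg_le_neg (min_le_left _ _)) (min_le_left _ _) ht

open Set in
/-- If `g` maps the vector field `v` to the Lipschitz vector field `H` along an integral curve `c`
of `v`, then integral curves of `H` starting at `g (c 0)` coincide with `g ∘ c`. -/
theorem LipschitzWith.eqOn_comp_of_integralCurve {E F : Type*} [NormedAddCommGroup E]
    [NormedSpace ℝ E] [NormedAddCommGroup F] [NormedSpace ℝ F] {H : F → F} {K : NNReal}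
    (hH : LipschitzWith K H) {v : E → E} {g : E → F} {c : ℝ → E} {δ : ℝ} (hδ : 0 < δ)
    (hg : ∀ t ∈ Ioo (-δ) δ, DifferentiableAt ℝ g (c t))
    (hgv : ∀ t ∈ Ioo (-δ) δ, fderiv ℝ g (c t) (v (c t)) = H (g (c t)))
    (hc : ∀ t ∈ Ioo (-δ) δ, HasDerivAt c (v (c t)) t)
    {f : ℝ → F} (hf : ∀ t ∈ Ioo (-δ) δ, HasDerivAt f (H (f t)) t) (hf0 : f 0 = g (c 0)) :
    EqOn f (g ∘ c) (Ioo (-δ) δ) :=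
  ODE_solution_unique_of_mem_Ioo (v := fun _ ↦ H) (s := fun _ ↦ univ) (t₀ := 0)
    (fun _ _ ↦ hH.lipschitzOnWith) (by simp [hδ]) (fun t ht ↦ ⟨hf t ht, mem_univ _⟩)
    (fun t ht ↦ ⟨by
      simpa only [Function.comp_apply, hgv t ht] using
        (hg t ht).hasFDerivAt.comp_hasDerivAt t (hc t ht), mem_univ _⟩) hf0


/-- With `H` and `Λ` Lipschitz and `(G_f, G)` a continuously differentiable
pair on an open set `Ω` satisfying the invariance PDE, for every `c_* ∈ Ω` there is a
local-in-time solution `c` of the coarse ODE with `c(0) = c_*`, and the unique solution of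
the augmented fine system with initial data `(G_f(c_*), G(c_*))` stays on the graph of
`(G_f, G)`: it equals `(G_f(c(t)), G(c(t)))` for `t ∈ (−δ, δ)`. -/
theorem locally_invariant_graph {N m : ℕ}
    (H : (Fin N → ℝ) → (Fin N → ℝ)) (K : NNReal) (hH : LipschitzWith K H)
    (Λ : (Fin N → ℝ) → (Fin m → ℝ)) (K' : NNReal) (hΛ : LipschitzWith K' Λ)
    (τ : ℝ) (hτ : 0 < τ)
    (Ω : Set (Fin m → ℝ)) (hΩ : IsOpen Ω)
    (Gf G : (Fin m → ℝ) → (Fin N → ℝ))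
    (hGf : ContDiffOn ℝ 1 Gf Ω) (hG : ContDiffOn ℝ 1 G Ω)
    (hPDEf : ∀ c ∈ Ω, fderiv ℝ Gf c (τ⁻¹ • (Λ (Gf c) - Λ (G c))) = H (Gf c))
    (hPDE : ∀ c ∈ Ω, fderiv ℝ G c (τ⁻¹ • (Λ (Gf c) - Λ (G c))) = H (G c))
    (cstar : Fin m → ℝ) (hcstar : cstar ∈ Ω) :
    ∃ δ > (0 : ℝ), ∃ c : ℝ → (Fin m → ℝ), c 0 = cstar ∧
      (∀ t ∈ Set.Ioo (-δ) δ, c t ∈ Ω) ∧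
      (∀ t ∈ Set.Ioo (-δ) δ,
        HasDerivAt c (τ⁻¹ • (Λ (Gf (c t)) - Λ (G (c t)))) t) ∧
      ∀ ff f : ℝ → (Fin N → ℝ),
        (∀ t : ℝ, HasDerivAt ff (H (ff t)) t) →
        (∀ t : ℝ, HasDerivAt f (H (f t)) t) →
        ff 0 = Gf cstar → f 0 = G cstar →
        ∀ t ∈ Set.Ioo (-δ) δ, ff t = Gf (c t) ∧ f t = G (c t) := by
  obtain ⟨Kf, sf, hsf, hLf⟩ := (hGf.contDiffAt (hΩ.mem_nhds hcstar)).exists_lipschitzOnWith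
  obtain ⟨Kg, sg, hsg, hLg⟩ := (hG.contDiffAt (hΩ.mem_nhds hcstar)).exists_lipschitzOnWith
  have hv : LipschitzOnWith (‖τ⁻¹‖₊ * (K' * Kf + K' * Kg))
      (fun c ↦ τ⁻¹ • (Λ (Gf c) - Λ (G c))) (sf ∩ sg ∩ Ω) :=
    (lipschitzWith_smul τ⁻¹).comp_lipschitzOnWith
      ((hΛ.comp_lipschitzOnWith (hLf.mono fun _ h ↦ h.1.1)).sub
        (hΛ.comp_lipschitzOnWith (hLg.mono fun _ h ↦ h.1.2)))
  obtain ⟨δ, hδ, c, hc0, hcs, hc⟩ := hv.exists_integralCurve_mem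
    (Filter.inter_mem (Filter.inter_mem hsf hsg) (hΩ.mem_nhds hcstar))
  have hcΩ : ∀ t ∈ Set.Ioo (-δ) δ, c t ∈ Ω := fun t ht ↦ (hcs t ht).2
  have hdiff {g : (Fin m → ℝ) → (Fin N → ℝ)} (hg : ContDiffOn ℝ 1 g Ω) :
      ∀ t ∈ Set.Ioo (-δ) δ, DifferentiableAt ℝ g (c t) := fun t ht ↦
    (hg.contDiffAt (hΩ.mem_nhds (hcΩ t ht))).differentiableAt one_ne_zero
  refine ⟨δ, hδ, c, hc0, hcΩ, hc, fun ff f hff hf hff0 hf0 t ht ↦ ⟨?_, ?_⟩⟩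
  · exact hH.eqOn_comp_of_integralCurve (v := fun c ↦ τ⁻¹ • (Λ (Gf c) - Λ (G c))) hδ
      (hdiff hGf) (fun t ht ↦ hPDEf _ (hcΩ t ht)) hc
      (fun t _ ↦ hff t) (by rw [hff0, hc0]) ht
  · exact hH.eqOn_comp_of_integralCurve (v := fun c ↦ τ⁻¹ • (Λ (Gf c) - Λ (G c))) hδ
      (hdiff hG) (fun t ht ↦ hPDE _ (hcΩ t ht)) hc
      (fun t _ ↦ hf t) (by rw [hf0, hc0]) ht
end
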